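/- Let P_<Q> be the completed quantum polynomial algebra with basis {t^alpha : alpha a dimension vector} and multiplication t^alpha t^beta = q^{-<alpha,beta>_a} t^{alpha+beta}. Then the map from H(Q) to P_<Q> defined on basis elements by [M] -> a_M^{-1} t^{dim M} is an algebra homomorphism. Equivalently, for all representations U, V with dim U = beta and dim V = gamma: Sum over isomorphism classes [W] of F_{UV}^W / a_W = q^{-<beta,gamma>_a} / (a_U * a_V). -/

import Mathlib

/- Common setup: finite quivers, finite-dimensional representations over a
finite field, subrepresentations, quotients, Hall numbers, quiver
Grassmannians and flags, extensions, and the (completed) Hall algebra,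
following J. Fei, "Counting using Hall algebras I. Quivers". -/

open scoped BigOperators

attribute [local instance] Classical.propDecidable

namespace HallPaper

/-- A finite quiver: finitely many vertices and arrows. -/
structure FinQuiver where
  V : Type
  A : Type
  [fV : Fintype V]
  [fA : Fintype A]
  src : A → V
  tgt : A → V

attribute [instance] FinQuiver.fV FinQuiver.fA

/-- The additive Euler form `⟨α,β⟩_a = ∑_v α(v)β(v) - ∑_a α(ta)β(ha)`. -/
def eulerForm (Q : FinQuiver) (α β : Q.V → ℤ) : ℤ :=
  (∑ v, α v * β v) - ∑ a, α (Q.src a) * β (Q.tgt a)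

/-- The additive Euler form on dimension vectors. -/
def eulerFormN (Q : FinQuiver) (α β : Q.V → ℕ) : ℤ :=
  eulerForm Q (fun v => (α v : ℤ)) (fun v => (β v : ℤ))

/-- `Q` has no oriented cycles. -/
def NoCycles (Q : FinQuiver) : Prop :=
  ¬ ∃ (n : ℕ) (c : Fin (n + 1) → Q.A),
      (∀ i : Fin n, Q.tgt (c i.castSucc) = Q.src (c i.succ)) ∧
      Q.tgt (c (Fin.last n)) = Q.src (c 0)

/-- A finite-dimensional representation of a finite quiver `Q` over `k`. -/
structure QRep (Q : FinQuiver) (k : Type) [Field k] where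
  space : Q.V → Type
  [acg : ∀ v, AddCommGroup (space v)]
  [mod : ∀ v, Module k (space v)]
  [fd : ∀ v, FiniteDimensional k (space v)]
  map : ∀ a : Q.A, space (Q.src a) →ₗ[k] space (Q.tgt a)

attribute [instance] QRep.acg QRep.mod QRep.fd

namespace QRep

variable {Q : FinQuiver} {k : Type} [Field k]

/-- The dimension vector of a representation. -/
noncomputable def dimVec (M : QRep Q k) : Q.V → ℕ :=
  fun v => Module.finrank k (M.space v)

/-- A morphism of quiver representations. -/
structure Hom (M N : QRep Q k) where
  app : ∀ v, M.space v →ₗ[k] N.space v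
  comm : ∀ (a : Q.A) (x : M.space (Q.src a)),
    app (Q.tgt a) (M.map a x) = N.map a (app (Q.src a) x)

/-- The identity morphism. -/
def Hom.id (M : QRep Q k) : Hom M M :=
  ⟨fun _ => LinearMap.id, fun _ _ => rfl⟩

/-- Composition of morphisms. -/
def Hom.comp {M N P : QRep Q k} (g : Hom N P) (f : Hom M N) : Hom M P :=
  ⟨fun v => (g.app v).comp (f.app v), fun a x => by
    simp only [LinearMap.comp_apply, f.comm, g.comm]⟩

/-- An isomorphism of quiver representations. -/
structure Iso (M N : QRep Q k) where
  app : ∀ v, M.space v ≃ₗ[k] N.space v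
  comm : ∀ (a : Q.A) (x : M.space (Q.src a)),
    app (Q.tgt a) (M.map a x) = N.map a (app (Q.src a) x)

/-- Two representations are isomorphic. -/
def IsIsomorphic (M N : QRep Q k) : Prop := Nonempty (Iso M N)

/-- `a_M`, the number of automorphisms of `M`. -/
noncomputable def autCard (M : QRep Q k) : ℕ := Nat.card (Iso M M)

/-- `|Hom_Q(M,N)|`. -/
noncomputable def homCard (M N : QRep Q k) : ℕ := Nat.card (Hom M N)

/-- A subrepresentation: a family of subspaces stable under all arrow maps. -/
structure SubRep (M : QRep Q k) where
  sub : ∀ v, Submodule k (M.space v)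
  stable : ∀ (a : Q.A) (x : M.space (Q.src a)),
    x ∈ sub (Q.src a) → M.map a x ∈ sub (Q.tgt a)

namespace SubRep

variable {M : QRep Q k}

/-- A subrepresentation as a representation in its own right. -/
def toRep (L : SubRep M) : QRep Q k where
  space := fun v => L.sub v
  acg := fun _ => inferInstance
  mod := fun _ => inferInstance
  fd := fun _ => inferInstance
  map := fun a => (M.map a).restrict (fun x hx => L.stable a x hx)

/-- The quotient representation `M/L`. -/
def quotRep (L : SubRep M) : QRep Q k where
  space := fun v => M.space v ⧸ L.sub v
  acg := fun _ => inferInstance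
  mod := fun _ => inferInstance
  fd := fun _ => inferInstance
  map := fun a => Submodule.mapQ _ _ (M.map a) (fun x hx => L.stable a x hx)

/-- The dimension vector of a subrepresentation. -/
noncomputable def dim (L : SubRep M) : Q.V → ℕ :=
  fun v => Module.finrank k (L.sub v)

/-- The zero subrepresentation predicate. -/
def IsZero (L : SubRep M) : Prop := ∀ v, L.sub v = ⊥

/-- The full subrepresentation predicate. -/
def IsFull (L : SubRep M) : Prop := ∀ v, L.sub v = ⊤

/-- Containment of subrepresentations. -/
def le (L L' : SubRep M) : Prop := ∀ v, L.sub v ≤ L'.sub v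

/-- The subquotient `L'/L` of two nested subrepresentations. -/
def subquot (L L' : SubRep M) (h : L.le L') : QRep Q k where
  space := fun v => (L'.sub v) ⧸ ((L.sub v).comap (L'.sub v).subtype)
  acg := fun _ => inferInstance
  mod := fun _ => inferInstance
  fd := fun _ => inferInstance
  map := fun a =>
    Submodule.mapQ _ _ ((M.map a).restrict (fun x hx => L'.stable a x hx))
      (fun x hx => by
        have hx' : (x : M.space (Q.src a)) ∈ L.sub (Q.src a) := hx
        have := L.stable a x hx'
        simpa [Submodule.mem_comap] using this)

end SubRep

/-- The number of points of the quiver Grassmannian `Gr_γ(M)`. -/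
noncomputable def grCard (γ : Q.V → ℕ) (M : QRep Q k) : ℕ :=
  Nat.card {L : SubRep M // L.dim = γ}

/-- The Hall number `F_{UV}^W`: the number of subrepresentations `L ⊆ W`
with `L ≅ V` and `W/L ≅ U`. -/
noncomputable def hallNum (U V W : QRep Q k) : ℕ :=
  Nat.card {L : SubRep W // IsIsomorphic L.toRep V ∧ IsIsomorphic L.quotRep U}

/-- The number of points of the quiver flag variety `Fl_{α_t ⋯ α_1}(M)`;
here `α i` is the dimension vector of the subquotient `L_{i+1}/L_i`. -/
noncomputable def flCard {t : ℕ} (α : Fin t → (Q.V → ℕ)) (M : QRep Q k) : ℕ :=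
  Nat.card {L : Fin (t + 1) → SubRep M //
    (L 0).IsZero ∧ (L (Fin.last t)).IsFull ∧
    (∀ i : Fin t, (L i.castSucc).le (L i.succ)) ∧
    (∀ i : Fin t, ∀ v, (L i.succ).dim v = (L i.castSucc).dim v + α i v)}

/-- Cochains: the space whose quotient by coboundaries is `Ext¹_Q(U,V)`. -/
abbrev Cochain (U V : QRep Q k) :=
  ∀ a : Q.A, U.space (Q.src a) →ₗ[k] V.space (Q.tgt a)

/-- The coboundary of a family of linear maps. -/
def coboundary {U V : QRep Q k} (f : ∀ v, U.space v →ₗ[k] V.space v) :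
    Cochain U V :=
  fun a => (V.map a).comp (f (Q.src a)) - (f (Q.tgt a)).comp (U.map a)

/-- Two cochains define the same class in `Ext¹_Q(U,V)`. -/
def extRel (U V : QRep Q k) (z z' : Cochain U V) : Prop :=
  ∃ f, z' = z + coboundary f

/-- `|Ext¹_Q(U,V)|`. -/
noncomputable def ext1Card (U V : QRep Q k) : ℕ := Nat.card (Quot (extRel U V))

/-- The middle term of the extension of `U` by `V` defined by a cochain. -/
def middle {U V : QRep Q k} (z : Cochain U V) : QRep Q k where
  space := fun v => V.space v × U.space v
  acg := fun _ => inferInstance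
  mod := fun _ => inferInstance
  fd := fun _ => inferInstance
  map := fun a =>
    LinearMap.prod
      ((V.map a).comp (LinearMap.fst k _ _) + (z a).comp (LinearMap.snd k _ _))
      ((U.map a).comp (LinearMap.snd k _ _))

/-- `|Ext_Q(U,V)_W|`: the number of classes in `Ext¹_Q(U,V)` of extensions
with middle term isomorphic to `W`. -/
noncomputable def extWCard (U V W : QRep Q k) : ℕ :=
  Nat.card {e : Quot (extRel U V) //
    ∃ z : Cochain U V, Quot.mk _ z = e ∧ IsIsomorphic (middle z) W}

/-- `T` is rigid, i.e. `Ext¹_Q(T,T) = 0`. -/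
def IsRigid (T : QRep Q k) : Prop :=
  ∀ z : Cochain T T, ∃ f, z = coboundary f

/-- Direct sum of two representations. -/
def dsum (M N : QRep Q k) : QRep Q k where
  space := fun v => M.space v × N.space v
  acg := fun _ => inferInstance
  mod := fun _ => inferInstance
  fd := fun _ => inferInstance
  map := fun a => (M.map a).prodMap (N.map a)

/-- Finite direct sums of representations. -/
def dsumFin {ι : Type} [Fintype ι] (f : ι → QRep Q k) : QRep Q k where
  space := fun v => ∀ i, (f i).space v
  acg := fun _ => inferInstance
  mod := fun _ => inferInstance
  fd := fun _ => inferInstance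
  map := fun a => LinearMap.pi (fun i => ((f i).map a).comp (LinearMap.proj i))

/-- A simple representation. -/
def IsSimple (M : QRep Q k) : Prop :=
  M.dimVec ≠ 0 ∧ ∀ L : SubRep M, L.IsZero ∨ L.IsFull

/-- An indecomposable representation. -/
def Indecomposable (M : QRep Q k) : Prop :=
  M.dimVec ≠ 0 ∧
    ∀ A B : QRep Q k, IsIsomorphic M (dsum A B) → A.dimVec = 0 ∨ B.dimVec = 0

end QRep

open QRep

/-- The affine space of `α`-dimensional representations: one matrix per arrow. -/
def StdRep (Q : FinQuiver) (k : Type) [Field k] (α : Q.V → ℕ) :=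
  ∀ a : Q.A, Matrix (Fin (α (Q.tgt a))) (Fin (α (Q.src a))) k

instance (Q : FinQuiver) (k : Type) [Field k] [Fintype k] (α : Q.V → ℕ) :
    Finite (StdRep Q k α) := by
  unfold StdRep; infer_instance

/-- A point of `Rep_α(Q)` as an abstract representation. -/
def StdRep.toQRep {Q : FinQuiver} {k : Type} [Field k] {α : Q.V → ℕ}
    (W : StdRep Q k α) : QRep Q k where
  space := fun v => Fin (α v) → k
  acg := fun _ => inferInstance
  mod := fun _ => inferInstance
  fd := fun _ => inferInstance
  map := fun a => Matrix.mulVecLin (W a)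

/-- Isomorphism relation on `α`-dimensional representations. -/
def isoRel (Q : FinQuiver) (k : Type) [Field k] (α : Q.V → ℕ)
    (W W' : StdRep Q k α) : Prop :=
  IsIsomorphic W.toQRep W'.toQRep

/-- Isomorphism classes of `α`-dimensional representations of `Q` over `k`. -/
def IsoClass (Q : FinQuiver) (k : Type) [Field k] (α : Q.V → ℕ) :=
  Quot (isoRel Q k α)

/-- A representative representation of an isomorphism class. -/
noncomputable def IsoClass.rep {Q : FinQuiver} {k : Type} [Field k]
    {α : Q.V → ℕ} (c : IsoClass Q k α) : QRep Q k :=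
  (Quot.out c).toQRep

/-- Isomorphism classes of representations of all dimension vectors. -/
abbrev TotalClass (Q : FinQuiver) (k : Type) [Field k] :=
  Σ α : Q.V → ℕ, IsoClass Q k α

/-- A representative of a class in `TotalClass`. -/
noncomputable def TotalClass.rep {Q : FinQuiver} {k : Type} [Field k]
    (c : TotalClass Q k) : QRep Q k :=
  c.2.rep

section Counting

variable (Q : FinQuiver) (k : Type) [Field k] [Fintype k]

/-- `|Rep_α(Q)(F_q)|`. -/
noncomputable def repCard (α : Q.V → ℕ) : ℕ := Nat.card (StdRep Q k α)

/-- `|GL_α(F_q)|`. -/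
noncomputable def glCard (α : Q.V → ℕ) : ℕ :=
  Nat.card (∀ v : Q.V, Matrix.GeneralLinearGroup (Fin (α v)) k)

/-- `r_α(q) = |Rep_α(Q)| / |GL_α|`. -/
noncomputable def rFun (α : Q.V → ℕ) : ℚ :=
  (repCard Q k α : ℚ) / (glCard Q k α : ℚ)

end Counting

section Slope

variable {Q : FinQuiver}

/-- The value of a weight (`ℤ`-linear functional) on a dimension vector. -/
def wt (σ : Q.V → ℤ) (α : Q.V → ℕ) : ℤ := ∑ v, σ v * α v

/-- The slope `μ(α) = σ(α)/θ(α)`. -/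
noncomputable def slope (σ θ : Q.V → ℤ) (α : Q.V → ℕ) : ℚ :=
  (wt σ α : ℚ) / (wt θ α : ℚ)

/-- `θ` is positive on all nonzero dimension vectors (so `σ/θ` is a slope
function). -/
def SlopeOK (θ : Q.V → ℤ) : Prop :=
  ∀ α : Q.V → ℕ, α ≠ 0 → 0 < wt θ α

variable {k : Type} [Field k]

/-- `μ`-semistability. -/
def IsSemistable (σ θ : Q.V → ℤ) (M : QRep Q k) : Prop :=
  ∀ L : SubRep M, ¬ L.IsZero → ¬ L.IsFull →
    slope σ θ L.dim ≤ slope σ θ M.dimVec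

/-- `μ`-stability. -/
def IsStable (σ θ : Q.V → ℤ) (M : QRep Q k) : Prop :=
  ∀ L : SubRep M, ¬ L.IsZero → ¬ L.IsFull →
    slope σ θ L.dim < slope σ θ M.dimVec

/-- `μ` is coprime to `α`: `μ(γ) ≠ μ(α)` for all `0 < γ < α`. -/
def Coprime (σ θ : Q.V → ℤ) (α : Q.V → ℕ) : Prop :=
  ∀ γ : Q.V → ℕ, γ ≠ 0 → γ ≤ α → γ ≠ α → slope σ θ γ ≠ slope σ θ α

end Slope

section Decomp

variable {Q : FinQuiver}

/-- Ordered decompositions `α = α_1 + ⋯ + α_s` into nonzero dimension vectors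
with strictly increasing slopes (Harder–Narasimhan type). -/
structure HNDecomp (σ θ : Q.V → ℤ) (α : Q.V → ℕ) where
  s : ℕ
  pos : 0 < s
  d : Fin s → (Q.V → ℕ)
  nonzero : ∀ i, d i ≠ 0
  total : ∑ i, d i = α
  incr : ∀ i j : Fin s, i < j → slope σ θ (d i) < slope σ θ (d j)

/-- Ordered decompositions `α = α_1 + ⋯ + α_s` into nonzero dimension vectors
with `μ(α_1 + ⋯ + α_k) < μ(α)` for all `k < s`. -/
structure StarDecomp (σ θ : Q.V → ℤ) (α : Q.V → ℕ) where
  s : ℕ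
  pos : 0 < s
  d : Fin s → (Q.V → ℕ)
  nonzero : ∀ i, d i ≠ 0
  total : ∑ i, d i = α
  partial_lt : ∀ kk : Fin s, (kk : ℕ) + 1 < s →
    slope σ θ (∑ i ∈ Finset.Iic kk, d i) < slope σ θ α

end Decomp

section Hall

variable (Q : FinQuiver) (k : Type) [Field k]

/-- The underlying space of the completed Hall algebra: formal (possibly
infinite) linear combinations of isomorphism classes. -/
abbrev HallAlg := TotalClass Q k → ℚ

/-- The Hall product `[U][V] = ∑_{[W]} F_{UV}^W [W]`, written on coefficient
functions. -/
noncomputable def hallMul (x y : HallAlg Q k) : HallAlg Q k :=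
  fun W => ∑ᶠ (U : TotalClass Q k) (V : TotalClass Q k),
    x U * y V * (hallNum U.rep V.rep W.rep : ℚ)

/-- The unit `[0]` of the Hall algebra. -/
noncomputable def hallOne : HallAlg Q k :=
  fun c => if c.1 = 0 then 1 else 0

/-- Iterated Hall product of a list. -/
noncomputable def hallProd (l : List (HallAlg Q k)) : HallAlg Q k :=
  l.foldr (hallMul Q k) (hallOne Q k)

/-- The twisted Hall product `[U][V] = ∑_{[W]} q^{⟨dim U, dim V⟩} F_{UV}^W [W]`. -/
noncomputable def hallMulTw [Fintype k] (x y : HallAlg Q k) : HallAlg Q k :=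
  fun W => ∑ᶠ (U : TotalClass Q k) (V : TotalClass Q k),
    x U * y V * ((Fintype.card k : ℚ) ^ eulerFormN Q U.rep.dimVec V.rep.dimVec) *
      (hallNum U.rep V.rep W.rep : ℚ)

/-- `χ_α`, the sum of all `[M]` with `dim M = α`. -/
noncomputable def chiElt (α : Q.V → ℕ) : HallAlg Q k :=
  fun c => if c.1 = α then 1 else 0

/-- `χ_α^{ss}`, the sum of all semistable `[M]` with `dim M = α`. -/
noncomputable def chiSS (σ θ : Q.V → ℤ) (α : Q.V → ℕ) : HallAlg Q k :=
  fun c => if c.1 = α ∧ IsSemistable σ θ c.rep then 1 else 0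

/-- The completed quantum polynomial algebra `P_{⟨Q⟩}` (coefficient functions
on monomials `t^α`). -/
abbrev QPoly := (Q.V → ℕ) → ℚ

/-- Multiplication `t^α t^β = q^{-⟨α,β⟩_a} t^{α+β}` of `P_{⟨Q⟩}`. -/
noncomputable def qpolyMul [Fintype k] (x y : QPoly Q) : QPoly Q :=
  fun α => ∑ᶠ (β : Q.V → ℕ) (γ : Q.V → ℕ),
    if β + γ = α then
      ((Fintype.card k : ℚ) ^ (-(eulerFormN Q β γ))) * x β * y γ
    else 0

/-- The unit of `P_{⟨Q⟩}`. -/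
noncomputable def qpolyOne : QPoly Q :=
  fun α => if α = 0 then 1 else 0

/-- The integration map `∫ : H(Q) → P_{⟨Q⟩}`, `[M] ↦ a_M⁻¹ t^{dim M}`. -/
noncomputable def intChar (x : HallAlg Q k) : QPoly Q :=
  fun α => ∑ᶠ c : IsoClass Q k α, x ⟨α, c⟩ / (autCard (IsoClass.rep c) : ℚ)

end Hall

section Chains

variable {Q : FinQuiver} {k : Type} [Field k]

/-- The number of strict chains `0 = W_0 < W_1 < ⋯ < W_i = W` of
subrepresentations. -/
noncomputable def chainCount (M : QRep Q k) (i : ℕ) : ℕ :=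
  Nat.card {L : Fin (i + 1) → SubRep M //
    (L 0).IsZero ∧ (L (Fin.last i)).IsFull ∧
    ∀ j : Fin i, (L j.castSucc).le (L j.succ) ∧
      (L j.castSucc).sub ≠ (L j.succ).sub}

/-- `F_W = ∑_i (-1)^i F_i(W)`, the alternating sum of numbers of strict
chains of subrepresentations. -/
noncomputable def FW (M : QRep Q k) : ℚ :=
  ∑ᶠ i : ℕ, (-1 : ℚ) ^ i * (chainCount M i : ℚ)

end Chains

section Proof

variable {Q : FinQuiver} {k : Type} [Field k]

theorem Iso.ext' {M N : QRep Q k} {f g : Iso M N} (h : ∀ v x, f.app v x = g.app v x) : f = g := by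
  cases f with
  | mk fa fc =>
    cases g with
    | mk ga gc =>
      have : fa = ga := funext fun v => LinearEquiv.ext fun x => h v x
      subst this
      rfl

theorem SubRep.ext' {M : QRep Q k} {f g : SubRep M} (h : f.sub = g.sub) : f = g := by
  cases f
  cases g
  cases h
  rfl

/-- Identity isomorphism. -/
def isoRefl (M : QRep Q k) : Iso M M := ⟨fun _ => LinearEquiv.refl k _, fun _ _ => rfl⟩

/-- Inverse isomorphism. -/
def isoSymm {M N : QRep Q k} (f : Iso M N) : Iso N M :=
  ⟨fun v => (f.app v).symm, fun a x => by
    rw [LinearEquiv.symm_apply_eq, f.comm, LinearEquiv.apply_symm_apply]⟩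

/-- Composition of isomorphisms. -/
def isoTrans {M N P : QRep Q k} (f : Iso M N) (g : Iso N P) : Iso M P :=
  ⟨fun v => (f.app v).trans (g.app v), fun a x => by
    simp only [LinearEquiv.trans_apply, f.comm, g.comm]⟩

theorem space_finite [Finite k] (M : QRep Q k) (v : Q.V) : Finite (M.space v) :=
  Module.finite_of_finite k

instance iso_finite [Finite k] (M N : QRep Q k) : Finite (Iso M N) := by
  have := space_finite M
  have := space_finite N
  refine Finite.of_injective (fun (f : Iso M N) v x => f.app v x) ?_
  intro f g h
  exact Iso.ext' fun v x => congrFun (congrFun h v) x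

instance subrep_finite [Finite k] (M : QRep Q k) : Finite (SubRep M) := by
  have := space_finite M
  refine Finite.of_injective (fun (f : SubRep M) v => (f.sub v : Set (M.space v))) ?_
  intro f g h
  exact SubRep.ext' (funext fun v => SetLike.coe_injective (congrFun h v))

theorem autCard_pos [Finite k] (M : QRep Q k) : 0 < autCard M := by
  have : Nonempty (Iso M M) := ⟨isoRefl M⟩
  exact Nat.card_pos

theorem card_iso (M N : QRep Q k) :
    Nat.card (Iso M N) = if IsIsomorphic M N then autCard N else 0 := by
  split_ifs with h
  · obtain ⟨f⟩ := h
    refine Nat.card_congr ⟨fun g => isoTrans (isoSymm f) g, fun g => isoTrans f g, ?_, ?_⟩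
    · intro g
      exact Iso.ext' fun v x => by simp [isoTrans, isoSymm]
    · intro g
      exact Iso.ext' fun v x => by simp [isoTrans, isoSymm]
  · have : IsEmpty (Iso M N) := not_nonempty_iff.mp h
    exact Nat.card_of_isEmpty

theorem card_iso' (M N : QRep Q k) :
    Nat.card (Iso M N) = if IsIsomorphic M N then autCard M else 0 := by
  have h1 : Nat.card (Iso M N) = Nat.card (Iso N M) :=
    Nat.card_congr ⟨isoSymm, isoSymm, fun g => Iso.ext' fun v x => by simp [isoSymm],
      fun g => Iso.ext' fun v x => by simp [isoSymm]⟩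
  have h2 : IsIsomorphic M N ↔ IsIsomorphic N M :=
    ⟨fun ⟨f⟩ => ⟨isoSymm f⟩, fun ⟨f⟩ => ⟨isoSymm f⟩⟩
  rw [h1, card_iso]
  simp only [h2]

theorem dimVec_eq_of_iso {M N : QRep Q k} (f : Iso M N) : M.dimVec = N.dimVec :=
  funext fun v => (f.app v).finrank_eq

theorem dimVec_rep (c : TotalClass Q k) : c.rep.dimVec = c.1 := by
  funext v
  show Module.finrank k (Fin (c.1 v) → k) = _
  simp

theorem isoRel_equiv (α : Q.V → ℕ) : Equivalence (isoRel Q k α) :=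
  ⟨fun W => ⟨isoRefl _⟩, fun ⟨f⟩ => ⟨isoSymm f⟩, fun ⟨f⟩ ⟨g⟩ => ⟨isoTrans f g⟩⟩

theorem exists_class (M : QRep Q k) : ∃ c : TotalClass Q k, IsIsomorphic M c.rep := by
  let b : ∀ v, Module.Basis (Fin (M.dimVec v)) k (M.space v) := fun v => Module.finBasis k (M.space v)
  let W : StdRep Q k M.dimVec := fun a =>
    LinearMap.toMatrix (b (Q.src a)) (b (Q.tgt a)) (M.map a)
  have f : Iso M W.toQRep :=
    ⟨fun v => (b v).equivFun, fun a x => by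
      show (b (Q.tgt a)).repr (M.map a x) = (W a).mulVec ((b (Q.src a)).repr x)
      rw [LinearMap.toMatrix_mulVec_repr]⟩
  refine ⟨⟨M.dimVec, Quot.mk _ W⟩, ?_⟩
  have h : Quot.mk (isoRel Q k M.dimVec) (Quot.out (Quot.mk (isoRel Q k M.dimVec) W)) = Quot.mk _ W :=
    Quot.out_eq _
  have h2 : isoRel Q k _ _ _ := ((isoRel_equiv M.dimVec).eqvGen_iff).1 (Quot.eqvGen_exact h)
  obtain ⟨g⟩ := h2
  exact ⟨isoTrans f (isoSymm g)⟩

theorem class_unique {c c' : TotalClass Q k} (h : IsIsomorphic c.rep c'.rep) : c = c' := by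
  have h1 : c.1 = c'.1 := by
    obtain ⟨f⟩ := h
    rw [← dimVec_rep c, ← dimVec_rep c', dimVec_eq_of_iso f]
  obtain ⟨α, c⟩ := c
  obtain ⟨α', c'⟩ := c'
  dsimp only at h1
  subst h1
  have : c = c' := by
    rw [← Quot.out_eq c, ← Quot.out_eq c']
    exact Quot.sound h
  rw [this]

/-- Short exact sequences `0 → V → W → U → 0`. -/
structure SES (U V W : QRep Q k) where
  i : ∀ v, V.space v →ₗ[k] W.space v
  p : ∀ v, W.space v →ₗ[k] U.space v
  ic : ∀ a x, i _ (V.map a x) = W.map a (i _ x)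
  pc : ∀ a x, p _ (W.map a x) = U.map a (p _ x)
  inj : ∀ v, Function.Injective (i v)
  surj : ∀ v, Function.Surjective (p v)
  exact : ∀ v x, p v x = 0 ↔ ∃ y, i v y = x

theorem SES.ext' {U V W : QRep Q k} {E F : SES U V W} (hi : E.i = F.i) (hp : E.p = F.p) : E = F := by
  cases E
  cases F
  cases hi
  cases hp
  rfl

variable {U V W : QRep Q k}

theorem SES.pi (E : SES U V W) (v : Q.V) (x : V.space v) : E.p v (E.i v x) = 0 :=
  (E.exact v _).2 ⟨x, rfl⟩

theorem SES.exists_section (E : SES U V W) :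
    ∃ s : ∀ v, U.space v →ₗ[k] W.space v, ∀ v u, E.p v (s v u) = u := by
  have : ∀ v, ∃ s : U.space v →ₗ[k] W.space v, ∀ u, E.p v (s u) = u := fun v => by
    obtain ⟨s, hs⟩ := (E.p v).exists_rightInverse_of_surjective
      (LinearMap.range_eq_top.2 (E.surj v))
    exact ⟨s, fun u => LinearMap.congr_fun hs u⟩
  choose s hs using this
  exact ⟨s, hs⟩

theorem SES.exists_retr (E : SES U V W) :
    ∃ r : ∀ v, W.space v →ₗ[k] V.space v, (∀ v x, r v (E.i v x) = x) ∧
      ∀ v w, E.p v w = 0 → E.i v (r v w) = w := by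
  have : ∀ v, ∃ r : W.space v →ₗ[k] V.space v, (∀ x, r (E.i v x) = x) := fun v => by
    obtain ⟨s, hs⟩ := (E.i v).exists_leftInverse_of_injective
      (LinearMap.ker_eq_bot.2 (E.inj v))
    exact ⟨s, fun u => LinearMap.congr_fun hs u⟩
  choose r hr using this
  refine ⟨r, hr, fun v w hw => ?_⟩
  obtain ⟨y, rfl⟩ := (E.exact v w).1 hw
  rw [hr]

/-- The underlying linear maps. -/
def appOf (t : Σ z : Cochain U V, Iso (middle z) W) (v : Q.V) :
    (V.space v × U.space v) →ₗ[k] W.space v :=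
  let e : (V.space v × U.space v) ≃ₗ[k] W.space v := t.2.app v
  e.toLinearMap

theorem appOf_bij (t : Σ z : Cochain U V, Iso (middle z) W) (v : Q.V) :
    Function.Bijective (appOf t v) :=
  (t.2.app v).bijective

theorem appOf_comm (t : Σ z : Cochain U V, Iso (middle z) W) (a : Q.A)
    (x : V.space (Q.src a)) (u : U.space (Q.src a)) :
    appOf t (Q.tgt a) (V.map a x + t.1 a u, U.map a u) = W.map a (appOf t (Q.src a) (x, u)) :=
  t.2.comm a (x, u)

theorem appOf_injective {t t' : Σ z : Cochain U V, Iso (middle z) W}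
    (h : ∀ v x, appOf t v x = appOf t' v x) : t = t' := by
  have hz : t.1 = t'.1 := by
    funext a
    refine LinearMap.ext fun u => ?_
    have h1 := appOf_comm t a 0 u
    have h2 := appOf_comm t' a 0 u
    rw [h (Q.src a), ← h2, ← h] at h1
    have h3 := (appOf_bij t _).1 h1
    simpa using h3
  obtain ⟨z, f⟩ := t
  obtain ⟨z', f'⟩ := t'
  dsimp only at hz
  subst hz
  have : f = f' := Iso.ext' fun v x => h v x
  rw [this]

theorem exists_iso (E : SES U V W) (s : ∀ v, U.space v →ₗ[k] W.space v)
    (hs : ∀ v u, E.p v (s v u) = u) :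
    ∃ t : Σ z : Cochain U V, Iso (middle z) W,
      ∀ v x, appOf t v x = E.i v x.1 + s v x.2 := by
  obtain ⟨r, hr, hr'⟩ := E.exists_retr
  let z : Cochain U V := fun a =>
    (r (Q.tgt a)).comp ((W.map a).comp (s (Q.src a)) - (s (Q.tgt a)).comp (U.map a))
  have hz : ∀ a u, E.i _ (z a u) = W.map a (s _ u) - s _ (U.map a u) := fun a u => by
    refine hr' _ _ ?_
    simp [E.pc, hs]
  let φ : ∀ v, (V.space v × U.space v) →ₗ[k] W.space v := fun v =>
    (E.i v).comp (LinearMap.fst k _ _) + (s v).comp (LinearMap.snd k _ _)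
  have hφ : ∀ v, Function.Bijective (φ v) := fun v => by
    constructor
    · rw [← LinearMap.ker_eq_bot, LinearMap.ker_eq_bot']
      rintro ⟨x, u⟩ h
      have h : E.i v x + s v u = 0 := h
      have hu : u = 0 := by
        have := congrArg (E.p v) h
        simpa [E.pi, hs] using this
      subst hu
      have hx : x = 0 := E.inj v (by simpa using h)
      rw [hx]
      rfl
    · intro w
      refine ⟨(r v (w - s v (E.p v w)), E.p v w), ?_⟩
      show E.i v (r v (w - s v (E.p v w))) + s v (E.p v w) = w
      rw [hr']
      · simp
      · simp [hs]
  refine ⟨⟨z, ⟨fun v => LinearEquiv.ofBijective (φ v) (hφ v), ?_⟩⟩, fun v x => rfl⟩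
  rintro a ⟨x, u⟩
  show E.i _ (V.map a x + z a u) + s _ (U.map a u) = W.map a (E.i _ x + s _ u)
  rw [map_add, map_add, hz, E.ic]
  abel

theorem card_sigma_iso :
    Nat.card (Σ z : Cochain U V, Iso (middle z) W) =
      Nat.card (SES U V W) * Nat.card (∀ v, U.space v →ₗ[k] V.space v) := by
  rw [← Nat.card_prod]
  choose s0 hs0 using fun E : SES U V W => E.exists_section
  have key : ∀ y : SES U V W × (∀ v, U.space v →ₗ[k] V.space v),
      ∃ t : Σ z : Cochain U V, Iso (middle z) W,
      ∀ v x, appOf t v x = y.1.i v x.1 + (s0 y.1 v + (y.1.i v).comp (y.2 v)) x.2 := fun y =>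
    exists_iso y.1 (fun v => s0 y.1 v + (y.1.i v).comp (y.2 v)) fun v u => by
      simp [hs0, SES.pi]
  choose Ψ hΨ using key
  symm
  refine Nat.card_eq_of_bijective Ψ ⟨?_, ?_⟩
  · rintro ⟨E, h⟩ ⟨E', h'⟩ hE
    have e : ∀ v (x : V.space v × U.space v), E.i v x.1 + (s0 E v + (E.i v).comp (h v)) x.2 =
        E'.i v x.1 + (s0 E' v + (E'.i v).comp (h' v)) x.2 := fun v x => by
      rw [← hΨ (E, h), ← hΨ (E', h'), hE]
    have hi : E.i = E'.i := funext fun v => LinearMap.ext fun x => by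
      simpa using e v (x, 0)
    have hp : E.p = E'.p := by
      funext v
      refine LinearMap.ext fun w => ?_
      obtain ⟨⟨x, u⟩, rfl⟩ := (appOf_bij (Ψ (E, h)) v).2 w
      have h1 : E.p v (appOf (Ψ (E, h)) v (x, u)) = u := by
        rw [hΨ]
        simp [hs0, SES.pi]
      have h2 : E'.p v (appOf (Ψ (E, h)) v (x, u)) = u := by
        rw [hE, hΨ]
        simp [hs0, SES.pi]
      rw [h1, h2]
    obtain rfl : E = E' := SES.ext' hi hp
    have : h = h' := by
      funext v
      refine LinearMap.ext fun u => E.inj v ?_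
      simpa using e v (0, u)
    rw [this]
  · intro t
    let e : ∀ v, (V.space v × U.space v) ≃ₗ[k] W.space v := fun v =>
      LinearEquiv.ofBijective (appOf t v) (appOf_bij t v)
    have he : ∀ v x, e v x = appOf t v x := fun v x => rfl
    have hc : ∀ a x u, e (Q.tgt a) (V.map a x + t.1 a u, U.map a u) = W.map a (e (Q.src a) (x, u)) :=
      fun a x u => appOf_comm t a x u
    let E : SES U V W :=
      { i := fun v => (e v).toLinearMap.comp (LinearMap.inl k _ _)
        p := fun v => (LinearMap.snd k _ _).comp (e v).symm.toLinearMap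
        ic := fun a x => by
          have := hc a x 0
          simpa using this
        pc := fun a w => by
          obtain ⟨⟨x, u⟩, rfl⟩ := (e _).surjective w
          simp [← hc]
        inj := fun v x y h => by
          have := (e v).injective h
          simpa using this
        surj := fun v u => ⟨e v (0, u), by simp⟩
        exact := fun v w => by
          obtain ⟨⟨x, u⟩, rfl⟩ := (e _).surjective w
          simp [eq_comm] }
    obtain ⟨r, hr, hr'⟩ := E.exists_retr
    refine ⟨(E, fun v => (r v).comp ((e v).toLinearMap.comp (LinearMap.inr k _ _) - s0 E v)), ?_⟩
    refine appOf_injective fun v x => ?_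
    rw [hΨ]
    obtain ⟨x, u⟩ := x
    have h1 : E.p v (e v (0, u)) = u := by simp [E]
    have h2 : E.i v (r v (e v (0, u) - s0 E v u)) = e v (0, u) - s0 E v u :=
      hr' _ _ (by rw [map_sub, h1, hs0, sub_self])
    have h3 : E.i v x = e v (x, 0) := rfl
    rw [← he]
    show E.i v x + (s0 E v u + E.i v (r v (e v (0, u) - s0 E v u))) = e v (x, u)
    rw [h2, h3, add_sub_cancel, ← map_add]
    simp

/-- The short exact sequence of a subrepresentation with identifications. -/
def sesOf (t : Σ L : SubRep W, Iso L.toRep V × Iso L.quotRep U) : SES U V W :=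
  let e : ∀ v, t.1.sub v ≃ₗ[k] V.space v := fun v => t.2.1.app v
  let e' : ∀ v, (W.space v ⧸ t.1.sub v) ≃ₗ[k] U.space v := fun v => t.2.2.app v
  have hc : ∀ a x, e (Q.tgt a) ⟨W.map a x.1, t.1.stable a _ x.2⟩ = V.map a (e _ x) :=
    fun a x => t.2.1.comm a x
  have hc' : ∀ a x, e' (Q.tgt a) ((t.1.sub _).mkQ (W.map a x)) = U.map a (e' _ ((t.1.sub _).mkQ x)) :=
    fun a x => t.2.2.comm a ((t.1.sub _).mkQ x)
  { i := fun v => (t.1.sub v).subtype.comp (e v).symm.toLinearMap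
    p := fun v => (e' v).toLinearMap.comp (t.1.sub v).mkQ
    ic := fun a x => by
      obtain ⟨x, rfl⟩ := (e _).surjective x
      simp [← hc]
    pc := fun a x => hc' a x
    inj := fun v => by
      rw [LinearMap.coe_comp]
      exact (Submodule.injective_subtype _).comp (e v).symm.injective
    surj := fun v => by
      rw [LinearMap.coe_comp]
      exact (e' v).surjective.comp (Submodule.mkQ_surjective _)
    exact := fun v x => by
      have : (e' v).toLinearMap.comp (t.1.sub v).mkQ x = 0 ↔ x ∈ t.1.sub v := by simp
      rw [this]
      constructor
      · intro hx
        exact ⟨e v ⟨x, hx⟩, by simp⟩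
      · rintro ⟨y, rfl⟩
        exact ((e v).symm y).2 }

theorem sesOf_i (t : Σ L : SubRep W, Iso L.toRep V × Iso L.quotRep U) (v : Q.V) (x : t.1.sub v) :
    (sesOf t).i v (t.2.1.app v x) = x.1 := by
  exact congrArg Subtype.val ((t.2.1.app v).symm_apply_apply x)

theorem sesOf_p (t : Σ L : SubRep W, Iso L.toRep V × Iso L.quotRep U) (v : Q.V) (x : W.space v) :
    (sesOf t).p v x = t.2.2.app v ((t.1.sub v).mkQ x) := rfl

theorem mem_sub_iff (t : Σ L : SubRep W, Iso L.toRep V × Iso L.quotRep U) (v : Q.V) (x : W.space v) :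
    x ∈ t.1.sub v ↔ (sesOf t).p v x = 0 := by
  rw [sesOf_p]
  constructor
  · intro h
    have : (t.1.sub v).mkQ x = 0 := by simpa using h
    rw [this]
    exact (t.2.2.app v).map_zero
  · intro h
    have : (t.1.sub v).mkQ x = 0 := (t.2.2.app v).map_eq_zero_iff.1 h
    simpa using this

theorem sesOf_bij : Function.Bijective (sesOf (U := U) (V := V) (W := W)) := by
  constructor
  · intro t t' h
    have hL : t.1 = t'.1 := by
      refine SubRep.ext' (funext fun v => Submodule.ext fun x => ?_)
      rw [mem_sub_iff, mem_sub_iff, h]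
    have hi := sesOf_i t
    have hi' := sesOf_i t'
    have hp := sesOf_p t
    have hp' := sesOf_p t'
    rw [h] at hi hp
    have hinj := (sesOf t').inj
    generalize sesOf t' = E at *
    obtain ⟨L, e, f⟩ := t
    obtain ⟨L', e', f'⟩ := t'
    dsimp only at hL
    subst hL
    have h1 : e = e' := Iso.ext' fun v x => hinj v ((hi v x).trans (hi' v x).symm)
    have h2 : f = f' := Iso.ext' fun v x => by
      obtain ⟨x, rfl⟩ := Submodule.mkQ_surjective (L.sub v) x
      exact (hp v x).symm.trans (hp' v x)
    rw [h1, h2]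
  · intro E
    let L : SubRep W := ⟨fun v => LinearMap.ker (E.p v), fun a x hx => by
      rw [LinearMap.mem_ker] at hx ⊢
      rw [E.pc, hx, map_zero]⟩
    let g : ∀ v, V.space v →ₗ[k] L.sub v := fun v => (E.i v).codRestrict (L.sub v) fun x => E.pi v x
    have hg : ∀ v, Function.Bijective (g v) := fun v => by
      constructor
      · intro x y hxy
        exact E.inj v (congrArg Subtype.val hxy)
      · rintro ⟨w, hw⟩
        obtain ⟨y, hy⟩ := (E.exact v w).1 hw
        exact ⟨y, Subtype.ext hy⟩
    let e0 : Iso V L.toRep := ⟨fun v => LinearEquiv.ofBijective (g v) (hg v), fun a x =>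
      Subtype.ext (E.ic a x)⟩
    let f : Iso L.quotRep U := ⟨fun v => (E.p v).quotKerEquivOfSurjective (E.surj v), fun a x => by
      obtain ⟨x, rfl⟩ := Submodule.mkQ_surjective (L.sub _) x
      exact E.pc a x⟩
    refine ⟨⟨L, isoSymm e0, f⟩, SES.ext' ?_ ?_⟩
    · funext v
      refine LinearMap.ext fun x => ?_
      have := sesOf_i ⟨L, isoSymm e0, f⟩ v (g v x)
      have h2 : (isoSymm e0).app v (g v x) = x := (e0.app v).symm_apply_apply x
      rw [h2] at this
      exact this
    · funext v
      refine LinearMap.ext fun x => ?_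
      rfl

theorem card_ses [Finite k] :
    Nat.card (SES U V W) = hallNum U V W * (autCard U * autCard V) := by
  rw [← Nat.card_eq_of_bijective _ (sesOf_bij (U := U) (V := V) (W := W))]
  have := Fintype.ofFinite (SubRep W)
  rw [Nat.card_sigma, hallNum, Nat.card_eq_fintype_card, Fintype.card_subtype, Finset.card_eq_sum_ones,
    Finset.sum_mul, Finset.sum_filter]
  refine Finset.sum_congr rfl fun L _ => ?_
  rw [Nat.card_prod, card_iso, card_iso]
  by_cases h1 : IsIsomorphic L.toRep V <;> by_cases h2 : IsIsomorphic L.quotRep U <;>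
    simp [h1, h2, mul_comm]

theorem card_homs [Fintype k] (U V : QRep Q k) (v w : Q.V) :
    Nat.card (U.space v →ₗ[k] V.space w) = Fintype.card k ^ (U.dimVec v * V.dimVec w) := by
  rw [Module.natCard_eq_pow_finrank (K := k), Module.finrank_linearMap, Nat.card_eq_fintype_card]
  rfl

theorem card_H [Fintype k] (U V : QRep Q k) :
    Nat.card (∀ v, U.space v →ₗ[k] V.space v) = Fintype.card k ^ (∑ v, U.dimVec v * V.dimVec v) := by
  rw [Nat.card_pi, ← Finset.prod_pow_eq_pow_sum]
  exact Finset.prod_congr rfl fun v _ => card_homs U V v v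

theorem card_cochain [Fintype k] (U V : QRep Q k) :
    Nat.card (Cochain U V) =
      Fintype.card k ^ (∑ a, U.dimVec (Q.src a) * V.dimVec (Q.tgt a)) := by
  rw [Nat.card_pi, ← Finset.prod_pow_eq_pow_sum]
  exact Finset.prod_congr rfl fun v _ => card_homs U V _ _

theorem finite_cochain [Fintype k] (U V : QRep Q k) : Finite (Cochain U V) := by
  have := space_finite U
  have := space_finite V
  have : ∀ a, Finite (U.space (Q.src a) →ₗ[k] V.space (Q.tgt a)) := fun a =>
    Finite.of_injective (fun f => (f : U.space (Q.src a) → V.space (Q.tgt a))) DFunLike.coe_injective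
  infer_instance

theorem hall_div [Fintype k] (U V W : QRep Q k) [Fintype (Cochain U V)] :
    (hallNum U V W : ℚ) / (autCard W : ℚ) =
      ((autCard U : ℚ) * autCard V * (Fintype.card k : ℚ) ^ (∑ v, U.dimVec v * V.dimVec v))⁻¹ *
        ∑ z : Cochain U V, if IsIsomorphic (middle z) W then 1 else 0 := by
  have h := card_sigma_iso (U := U) (V := V) (W := W)
  rw [card_ses, card_H, Nat.card_sigma] at h
  simp only [card_iso] at h
  have h' : (∑ z : Cochain U V, if IsIsomorphic (middle z) W then (1 : ℚ) else 0) * autCard W =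
      hallNum U V W * (autCard U * autCard V) *
        (Fintype.card k : ℚ) ^ (∑ v, U.dimVec v * V.dimVec v) := by
    have := congrArg (Nat.cast : ℕ → ℚ) h
    push_cast at this
    rw [← this, Finset.sum_mul]
    refine Finset.sum_congr rfl fun z _ => ?_
    split_ifs <;> simp
  have a1 : (autCard U : ℚ) ≠ 0 := by exact_mod_cast (autCard_pos U).ne'
  have a2 : (autCard V : ℚ) ≠ 0 := by exact_mod_cast (autCard_pos V).ne'
  have a3 : (autCard W : ℚ) ≠ 0 := by exact_mod_cast (autCard_pos W).ne'
  have a4 : (Fintype.card k : ℚ) ≠ 0 := by exact_mod_cast Fintype.card_ne_zero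
  have a5 := pow_ne_zero (∑ v, U.dimVec v * V.dimVec v) a4
  rw [div_eq_iff a3, mul_assoc, h']
  field_simp

theorem main_sum [Fintype k] (U V : QRep Q k) :
    (∑ᶠ c : TotalClass Q k, (hallNum U V c.rep : ℚ) / (autCard c.rep : ℚ)) =
      ((Fintype.card k : ℚ) ^ (-(eulerFormN Q U.dimVec V.dimVec))) /
        ((autCard U : ℚ) * (autCard V : ℚ)) := by
  have := finite_cochain U V
  have := Fintype.ofFinite (Cochain U V)
  simp only [hall_div]
  choose cls hcls using fun z : Cochain U V => exists_class (middle z)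
  have hiff : ∀ z (c : TotalClass Q k), IsIsomorphic (middle z) c.rep ↔ c = cls z := by
    intro z c
    constructor
    · rintro ⟨f⟩
      obtain ⟨g⟩ := hcls z
      exact class_unique ⟨isoTrans (isoSymm f) g⟩
    · rintro rfl
      exact hcls z
  simp only [hiff]
  have hsupp : ∀ z, Function.support (fun c : TotalClass Q k => if c = cls z then (1 : ℚ) else 0) ⊆
      (({cls z} : Finset (TotalClass Q k)) : Set _) := by
    intro z c hc
    by_contra h
    apply hc
    simp at h
    simp [h]
  have hfin : ∀ z, Function.HasFiniteSupport
      (fun c : TotalClass Q k => if c = cls z then (1 : ℚ) else 0) := fun z =>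
    (Finset.finite_toSet _).subset (hsupp z)
  rw [← mul_finsum, finsum_sum_comm _ _ (fun z _ => hfin z)]
  · have h1 : ∀ z, ∑ᶠ c : TotalClass Q k, (if c = cls z then (1 : ℚ) else 0) = 1 := fun z => by
      rw [finsum_eq_sum_of_support_subset _ (hsupp z)]
      simp
    simp only [h1]
    rw [Finset.sum_const, Finset.card_univ, ← Nat.card_eq_fintype_card (α := Cochain U V), card_cochain]
    have a4 : (Fintype.card k : ℚ) ≠ 0 := by exact_mod_cast Fintype.card_ne_zero
    have e : -(eulerFormN Q U.dimVec V.dimVec) =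
        ((∑ a, U.dimVec (Q.src a) * V.dimVec (Q.tgt a) : ℕ) : ℤ) -
          ((∑ v, U.dimVec v * V.dimVec v : ℕ) : ℤ) := by
      simp [eulerFormN, eulerForm]
    rw [e, zpow_sub₀ a4, zpow_natCast, zpow_natCast]
    simp only [nsmul_eq_mul, mul_one, Nat.cast_pow, mul_inv, div_eq_mul_inv]
    ring
  all_goals
    refine Set.Finite.subset (Set.finite_range cls) ?_
    intro c hc
    by_contra h
    apply hc
    refine Finset.sum_eq_zero fun z _ => ?_
    rw [if_neg]
    rintro rfl
    exact h ⟨z, rfl⟩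

theorem hallNum_dim {U V W : QRep Q k} (h : hallNum U V W ≠ 0) : U.dimVec + V.dimVec = W.dimVec := by
  have : Nonempty {L : SubRep W // IsIsomorphic L.toRep V ∧ IsIsomorphic L.quotRep U} := by
    by_contra hne
    rw [not_nonempty_iff] at hne
    exact h Nat.card_of_isEmpty
  obtain ⟨L, ⟨f⟩, ⟨g⟩⟩ := this
  rw [← dimVec_eq_of_iso f, ← dimVec_eq_of_iso g]
  funext v
  exact Submodule.finrank_quotient_add_finrank (L.sub v)

instance isoClass_finite [Fintype k] (α : Q.V → ℕ) : Finite (IsoClass Q k α) :=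
  Finite.of_surjective (Quot.mk (isoRel Q k α)) Quot.mk_surjective

theorem sum_fixed [Fintype k] (α : Q.V → ℕ) [Fintype (IsoClass Q k α)] (U V : QRep Q k) :
    (∑ c : IsoClass Q k α, (hallNum U V c.rep : ℚ) / (autCard c.rep : ℚ)) =
      if U.dimVec + V.dimVec = α then
        ((Fintype.card k : ℚ) ^ (-(eulerFormN Q U.dimVec V.dimVec))) /
          ((autCard U : ℚ) * (autCard V : ℚ)) else 0 := by
  split_ifs with h
  · rw [← main_sum]
    rw [finsum_eq_sum_of_support_subset (s := ({α} : Finset (Q.V → ℕ)).sigma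
      fun β => if hb : β = α then hb ▸ (Finset.univ : Finset (IsoClass Q k α)) else ∅)]
    · rw [Finset.sum_sigma, Finset.sum_singleton]
      simp [TotalClass.rep]
    · rintro ⟨β, c⟩ hc
      have hn : hallNum U V (TotalClass.rep ⟨β, c⟩) ≠ 0 := by
        intro h0
        apply hc
        simp [h0]
      have hd := hallNum_dim hn
      rw [dimVec_rep] at hd
      dsimp only at hd
      rw [h] at hd
      subst hd
      simp
  · refine Finset.sum_eq_zero fun c _ => ?_
    have : hallNum U V c.rep = 0 := by
      by_contra hn
      have hd := hallNum_dim hn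
      have h2 := dimVec_rep (⟨α, c⟩ : TotalClass Q k)
      exact h (hd.trans h2)
    simp [this]

theorem rep_mk_dim {α : Q.V → ℕ} (c : IsoClass Q k α) : c.rep.dimVec = α :=
  dimVec_rep (⟨α, c⟩ : TotalClass Q k)

theorem int_mul [Fintype k] (x y : HallAlg Q k) :
    intChar Q k (hallMul Q k x y) = qpolyMul Q k (intChar Q k x) (intChar Q k y) := by
  have inst : ∀ α : Q.V → ℕ, Fintype (IsoClass Q k α) := fun α => Fintype.ofFinite _
  funext α
  let S : Finset (TotalClass Q k) := (Finset.Iic α).sigma fun _ => Finset.univ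
  have hS : ∀ c : TotalClass Q k, c ∈ S ↔ c.1 ≤ α := fun c => by simp [S]
  have hmul : ∀ W : IsoClass Q k α, hallMul Q k x y ⟨α, W⟩ =
      ∑ U ∈ S, ∑ V ∈ S, x U * y V * (hallNum U.rep V.rep W.rep : ℚ) := by
    intro W
    have hd : ∀ U V : TotalClass Q k, x U * y V * (hallNum U.rep V.rep W.rep : ℚ) ≠ 0 →
        U ∈ S ∧ V ∈ S := by
      intro U V h
      have hn : hallNum U.rep V.rep W.rep ≠ 0 := by
        intro h0
        apply h
        simp [h0]
      have := hallNum_dim hn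
      rw [dimVec_rep, dimVec_rep, rep_mk_dim] at this
      rw [hS, hS, ← this]
      exact ⟨fun v => Nat.le_add_right _ _, fun v => Nat.le_add_left _ _⟩
    have h1 : ∀ U : TotalClass Q k, ∑ᶠ V : TotalClass Q k, x U * y V * (hallNum U.rep V.rep W.rep : ℚ)
        = ∑ V ∈ S, x U * y V * (hallNum U.rep V.rep W.rep : ℚ) := fun U =>
      finsum_eq_sum_of_support_subset _ fun V hV => (hd U V hV).2
    show ∑ᶠ (U : TotalClass Q k) (V : TotalClass Q k),
      x U * y V * (hallNum U.rep V.rep W.rep : ℚ) = _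
    simp only [h1]
    refine finsum_eq_sum_of_support_subset _ fun U hU => ?_
    obtain ⟨V, _, hV⟩ := Finset.exists_ne_zero_of_sum_ne_zero hU
    exact (hd U V hV).1
  have hint : ∀ (z : HallAlg Q k) β, intChar Q k z β =
      ∑ c : IsoClass Q k β, z ⟨β, c⟩ / (autCard c.rep : ℚ) := fun z β => by
    rw [intChar, finsum_eq_sum_of_fintype]
  have hq : ∀ f g : QPoly Q, qpolyMul Q k f g α = ∑ β ∈ Finset.Iic α, ∑ γ ∈ Finset.Iic α,
      if β + γ = α then ((Fintype.card k : ℚ) ^ (-(eulerFormN Q β γ))) * f β * g γ else 0 := by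
    intro f g
    have hd : ∀ β γ : Q.V → ℕ,
        (if β + γ = α then ((Fintype.card k : ℚ) ^ (-(eulerFormN Q β γ))) * f β * g γ else 0) ≠ 0 →
        β ∈ Finset.Iic α ∧ γ ∈ Finset.Iic α := by
      intro β γ h
      have : β + γ = α := by
        by_contra h0
        exact h (if_neg h0)
      rw [Finset.mem_Iic, Finset.mem_Iic, ← this]
      exact ⟨fun v => Nat.le_add_right _ _, fun v => Nat.le_add_left _ _⟩
    have h1 : ∀ β : Q.V → ℕ, ∑ᶠ γ : Q.V → ℕ,
        (if β + γ = α then ((Fintype.card k : ℚ) ^ (-(eulerFormN Q β γ))) * f β * g γ else 0) =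
        ∑ γ ∈ Finset.Iic α,
        (if β + γ = α then ((Fintype.card k : ℚ) ^ (-(eulerFormN Q β γ))) * f β * g γ else 0) :=
      fun β => finsum_eq_sum_of_support_subset _ fun γ hγ => (hd β γ hγ).2
    unfold qpolyMul
    simp only [h1]
    refine finsum_eq_sum_of_support_subset _ fun β hβ => ?_
    obtain ⟨γ, _, hγ⟩ := Finset.exists_ne_zero_of_sum_ne_zero hβ
    exact (hd β γ hγ).1
  rw [hint, hq]
  have e1 : ∀ W : IsoClass Q k α, hallMul Q k x y ⟨α, W⟩ / (autCard W.rep : ℚ) =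
      ∑ U ∈ S, ∑ V ∈ S, x U * y V * ((hallNum U.rep V.rep W.rep : ℚ) / (autCard W.rep : ℚ)) := by
    intro W
    rw [hmul, Finset.sum_div]
    refine Finset.sum_congr rfl fun U _ => ?_
    rw [Finset.sum_div]
    exact Finset.sum_congr rfl fun V _ => mul_div_assoc _ _ _
  simp only [e1]
  rw [Finset.sum_comm]
  have e2 : ∀ U ∈ S, ∑ W : IsoClass Q k α, ∑ V ∈ S,
      x U * y V * ((hallNum U.rep V.rep W.rep : ℚ) / (autCard W.rep : ℚ)) =
      ∑ V ∈ S, x U * y V * (if U.1 + V.1 = α then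
        ((Fintype.card k : ℚ) ^ (-(eulerFormN Q U.1 V.1))) /
          ((autCard U.rep : ℚ) * (autCard V.rep : ℚ)) else 0) := by
    intro U _
    rw [Finset.sum_comm]
    refine Finset.sum_congr rfl fun V _ => ?_
    rw [← Finset.mul_sum, sum_fixed, dimVec_rep, dimVec_rep]
  rw [Finset.sum_congr rfl e2, Finset.sum_sigma]
  refine Finset.sum_congr rfl fun β _ => ?_
  simp only [S, Finset.sum_sigma]
  rw [Finset.sum_comm]
  refine Finset.sum_congr rfl fun γ _ => ?_
  by_cases h : β + γ = α
  · simp only [h, if_true]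
    rw [hint, hint, mul_assoc, Finset.sum_mul_sum, Finset.mul_sum]
    refine Finset.sum_congr rfl fun c _ => ?_
    rw [Finset.mul_sum]
    refine Finset.sum_congr rfl fun d _ => ?_
    simp only [TotalClass.rep, div_eq_mul_inv, mul_inv]
    ring
  · simp [h]

theorem int_one [Fintype k] : intChar Q k (hallOne Q k) = qpolyOne Q := by
  funext α
  by_cases h : α = 0
  · subst h
    have hsub : ∀ c c' : IsoClass Q k (0 : Q.V → ℕ), c = c' := by
      intro c c'
      induction c using Quot.ind with | _ W =>
      induction c' using Quot.ind with | _ W' =>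
      have : W = W' := by
        funext a
        ext i j
        exact Fin.elim0 i
      rw [this]
    let W0 : StdRep Q k (0 : Q.V → ℕ) := fun a => 0
    have : Unique (IsoClass Q k (0 : Q.V → ℕ)) := ⟨⟨Quot.mk _ W0⟩, fun c => hsub _ _⟩
    have haut : ∀ c : IsoClass Q k (0 : Q.V → ℕ), autCard c.rep = 1 := by
      intro c
      have hs : Subsingleton (Iso c.rep c.rep) := ⟨fun f g => Iso.ext' fun v x => by
        funext i
        exact Fin.elim0 i⟩
      have : Nonempty (Iso c.rep c.rep) := ⟨isoRefl _⟩
      exact Nat.card_eq_one_iff_unique.2 ⟨hs, this⟩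
    unfold intChar
    rw [finsum_unique, haut]
    simp [hallOne, qpolyOne]
  · simp [intChar, hallOne, qpolyOne, h]

end Proof

/-- the integration map `∫ : H(Q) → P_{⟨Q⟩}`,
`[M] ↦ a_M⁻¹ t^{dim M}`, is an algebra homomorphism; equivalently, for all
representations `U, V` with `dim U = β`, `dim V = γ`,
`∑_{[W]} F_{UV}^W / a_W = q^{-⟨β,γ⟩_a} / (a_U a_V)`. -/
theorem statement1 (Q : FinQuiver) (k : Type) [Field k] [Fintype k] :
    (∀ x y : HallAlg Q k,
        intChar Q k (hallMul Q k x y) =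
          qpolyMul Q k (intChar Q k x) (intChar Q k y)) ∧
    intChar Q k (hallOne Q k) = qpolyOne Q ∧
    ∀ (U V : QRep Q k) (β γ : Q.V → ℕ), U.dimVec = β → V.dimVec = γ →
      (∑ᶠ c : TotalClass Q k,
          (hallNum U V c.rep : ℚ) / (autCard c.rep : ℚ)) =
        ((Fintype.card k : ℚ) ^ (-(eulerFormN Q β γ))) /
          ((autCard U : ℚ) * (autCard V : ℚ)) := by
  refine ⟨int_mul, int_one, ?_⟩
  rintro U V β γ rfl rfl
  exact main_sum U V

end HallPaper
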